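/- (Supersolution property of the comparison function) Let n ≥ 2, 0 < r < 1, A ≥ 0, c ∈ ℝ, 0 < α < 1, β = 1 − α, ε > 0, and define v̄(x,t) = c + 7r⁻²At + 2r⁻²A|x|² for (x,t) ∈ ℝⁿ × ℝ. Then for every (x,t) ∈ ℝⁿ × ℝ, (1/2)·sup_{ν ∈ S^{n−1}} 𝒜v̄(x,ν,t−ε²/2) + (1/2)·inf_{ν ∈ S^{n−1}} 𝒜v̄(x,ν,t−ε²/2) ≤ v̄(x,t) − (3/2)r⁻²Aε², where 𝒜v̄(x,ν,s) = α·v̄(x+εν, s) + β·⨍_{B_ε^ν} v̄(x+h, s) dℋ^{n−1}(h) and B_ε^ν = {h ∈ ℝⁿ : ⟨h,ν⟩ = 0, |h| ≤ ε}. -/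

import Mathlib

open MeasureTheory Metric Set
open scoped RealInnerProductSpace

noncomputable def sliceAvg (n : ℕ) (ε : ℝ) (u : EuclideanSpace ℝ (Fin n) → ℝ → ℝ)
    (x ν : EuclideanSpace ℝ (Fin n)) (s : ℝ) : ℝ :=
  ⨍ h in {h : EuclideanSpace ℝ (Fin n) | ⟪h, ν⟫ = 0 ∧ ‖h‖ ≤ ε},
    u (x + h) s ∂(μH[(n : ℝ) - 1])

noncomputable def dppOp (n : ℕ) (α ε : ℝ) (u : EuclideanSpace ℝ (Fin n) → ℝ → ℝ)
    (x ν : EuclideanSpace ℝ (Fin n)) (s : ℝ) : ℝ :=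
  α * u (x + ε • ν) s + (1 - α) * sliceAvg n ε u x ν s

noncomputable def dppMidrange (n : ℕ) (α ε : ℝ) (u : EuclideanSpace ℝ (Fin n) → ℝ → ℝ)
    (x : EuclideanSpace ℝ (Fin n)) (s : ℝ) : ℝ :=
  (1/2) * sSup ((fun ν => dppOp n α ε u x ν s) '' sphere (0 : EuclideanSpace ℝ (Fin n)) 1)
    + (1/2) * sInf ((fun ν => dppOp n α ε u x ν s) '' sphere (0 : EuclideanSpace ℝ (Fin n)) 1)

def SatisfiesDPP (n : ℕ) (α ε : ℝ) (ΩT : Set (EuclideanSpace ℝ (Fin n) × ℝ))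
    (u : EuclideanSpace ℝ (Fin n) → ℝ → ℝ) : Prop :=
  ∀ x t, (x, t) ∈ ΩT → u x t = dppMidrange n α ε u x (t - ε ^ 2 / 2)

lemma slice_meas {n : ℕ} (hn : 2 ≤ n) {ε : ℝ} (hε : 0 < ε) (ν : EuclideanSpace ℝ (Fin n))
    (hν : ‖ν‖ = 1) :
    (μH[(n : ℝ) - 1] : Measure (EuclideanSpace ℝ (Fin n)))
      {h : EuclideanSpace ℝ (Fin n) | ⟪h, ν⟫ = 0 ∧ ‖h‖ ≤ ε} ≠ 0 ∧
    (μH[(n : ℝ) - 1] : Measure (EuclideanSpace ℝ (Fin n)))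
      {h : EuclideanSpace ℝ (Fin n) | ⟪h, ν⟫ = 0 ∧ ‖h‖ ≤ ε} ≠ ⊤ := by
  have hν0 : ν ≠ 0 := by rintro rfl; simp at hν
  obtain ⟨m, rfl⟩ : ∃ m, n = m + 1 := ⟨n - 1, by omega⟩
  have : Fact (Module.finrank ℝ (EuclideanSpace ℝ (Fin (m+1))) = m + 1) := ⟨by simp⟩
  have hf : Module.finrank ℝ ((ℝ ∙ ν)ᗮ : Submodule ℝ (EuclideanSpace ℝ (Fin (m+1)))) = m :=
    Submodule.finrank_orthogonal_span_singleton hν0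
  have hS : {h : EuclideanSpace ℝ (Fin (m+1)) | ⟪h, ν⟫ = 0 ∧ ‖h‖ ≤ ε} =
      ((↑) : ((ℝ ∙ ν)ᗮ : Submodule ℝ (EuclideanSpace ℝ (Fin (m+1)))) → _) ''
        (closedBall 0 ε) := by
    ext h
    constructor
    · rintro ⟨h1, h2⟩
      exact ⟨⟨h, Submodule.mem_orthogonal_singleton_iff_inner_left.2 h1⟩, by simpa using h2, rfl⟩
    · rintro ⟨⟨y, hy⟩, h2, rfl⟩
      exact ⟨Submodule.mem_orthogonal_singleton_iff_inner_left.1 hy, by simpa using h2⟩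
  have hd : (((m + 1 : ℕ) : ℝ) - 1) =
      (Module.finrank ℝ ((ℝ ∙ ν)ᗮ : Submodule ℝ (EuclideanSpace ℝ (Fin (m+1)))) : ℝ) := by
    rw [hf]; push_cast; ring
  rw [hS, hd, Isometry.hausdorffMeasure_image isometry_subtype_coe (Or.inl (by positivity))]
  exact ⟨(measure_closedBall_pos _ _ hε).ne', measure_closedBall_lt_top.ne⟩

lemma slice_bounds {n : ℕ} (hn : 2 ≤ n) {ε : ℝ} (hε : 0 < ε) (x ν : EuclideanSpace ℝ (Fin n))
    (hν : ‖ν‖ = 1) (K k : ℝ) (hk : 0 ≤ k) :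
    K ≤ (⨍ h in {h : EuclideanSpace ℝ (Fin n) | ⟪h, ν⟫ = 0 ∧ ‖h‖ ≤ ε},
      (K + k * ‖x + h‖ ^ 2) ∂(μH[(n : ℝ) - 1])) ∧
    (⨍ h in {h : EuclideanSpace ℝ (Fin n) | ⟪h, ν⟫ = 0 ∧ ‖h‖ ≤ ε},
      (K + k * ‖x + h‖ ^ 2) ∂(μH[(n : ℝ) - 1])) ≤ K + k * (‖x‖ ^ 2 + ε ^ 2) := by
  obtain ⟨h0, h1⟩ := slice_meas hn hε ν hν
  set S := {h : EuclideanSpace ℝ (Fin n) | ⟪h, ν⟫ = 0 ∧ ‖h‖ ≤ ε} with hSdef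
  set μ : Measure (EuclideanSpace ℝ (Fin n)) := μH[(n : ℝ) - 1] with hμ
  have hcl : IsClosed S :=
    (isClosed_eq (f := fun h : EuclideanSpace ℝ (Fin n) => ⟪h, ν⟫) (by fun_prop)
      continuous_const).inter (isClosed_le continuous_norm continuous_const)
  have hcomp : IsCompact S :=
    (isCompact_closedBall (0 : EuclideanSpace ℝ (Fin n)) ε).of_isClosed_subset hcl
      (fun h hh => by simpa using hh.2)
  have hint : ∀ f : EuclideanSpace ℝ (Fin n) → ℝ, Continuous f → IntegrableOn f S μ :=
    fun f hf => hf.continuousOn.integrableOn_of_subset_isCompact hcomp hcl.measurableSet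
      subset_rfl h1
  have hpos : 0 < μ.real S := ENNReal.toReal_pos h0 h1
  have hodd : ∫ h in S, ⟪x, h⟫ ∂μ = 0 := by
    have e := ((IsometryEquiv.neg (EuclideanSpace ℝ (Fin n))).measurePreserving_hausdorffMeasure
      ((n : ℝ) - 1)).setIntegral_preimage_emb
        (IsometryEquiv.neg (EuclideanSpace ℝ (Fin n))).toHomeomorph.measurableEmbedding
        (fun h => ⟪x, h⟫) S
    have hp : (IsometryEquiv.neg (EuclideanSpace ℝ (Fin n))) ⁻¹' S = S := by
      ext h; simp [hSdef]
    rw [hp] at e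
    simp only [IsometryEquiv.neg_apply, inner_neg_right, integral_neg] at e
    linarith
  have hc1 : ∀ C : ℝ, ∫ _h in S, C ∂μ = μ.real S * C := fun C => by simp
  rw [setAverage_eq, smul_eq_mul, inv_mul_eq_div, le_div_iff₀ hpos, div_le_iff₀ hpos]
  constructor
  · rw [mul_comm, ← hc1]
    exact setIntegral_mono (hint _ (by fun_prop)) (hint _ (by fun_prop))
      (fun h => by have : 0 ≤ k * ‖x + h‖ ^ 2 := by positivity
                   simpa using this)
  · calc _ ≤ ∫ h in S, ((K + k * (‖x‖ ^ 2 + ε ^ 2)) + (2 * k) * ⟪x, h⟫) ∂μ := by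
          refine setIntegral_mono_on (hint _ (by fun_prop)) (hint _ (by fun_prop))
            hcl.measurableSet (fun h hh => ?_)
          rw [norm_add_sq_real]
          have : ‖h‖ ^ 2 ≤ ε ^ 2 := pow_le_pow_left₀ (norm_nonneg _) hh.2 2
          nlinarith [mul_le_mul_of_nonneg_left this hk]
      _ = _ := by
          rw [integral_add (hint _ (by fun_prop)) (hint _ (by fun_prop)), hc1,
            integral_const_mul, hodd]
          ring

/-- supersolution property of the comparison function
`v̄(x,t) = c + 7r⁻²At + 2r⁻²A|x|²`. -/
theorem stmt_10 {n : ℕ} (hn : 2 ≤ n) (r A c α ε : ℝ)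
    (hr : 0 < r) (hr1 : r < 1) (hA : 0 ≤ A) (hα : 0 < α) (hα1 : α < 1) (hε : 0 < ε) :
    ∀ (x : EuclideanSpace ℝ (Fin n)) (t : ℝ),
      dppMidrange n α ε
          (fun y s => c + 7 * (r ^ 2)⁻¹ * A * s + 2 * (r ^ 2)⁻¹ * A * ‖y‖ ^ 2)
          x (t - ε ^ 2 / 2)
        ≤ (c + 7 * (r ^ 2)⁻¹ * A * t + 2 * (r ^ 2)⁻¹ * A * ‖x‖ ^ 2)
            - (3 / 2) * (r ^ 2)⁻¹ * A * ε ^ 2 := by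
  intro x t
  set K := c + 7 * (r ^ 2)⁻¹ * A * (t - ε ^ 2 / 2) with hK
  set k := 2 * (r ^ 2)⁻¹ * A with hkdef
  have hk : 0 ≤ k := by positivity
  set F : EuclideanSpace ℝ (Fin n) → ℝ := fun ν => dppOp n α ε
    (fun y s => c + 7 * (r ^ 2)⁻¹ * A * s + k * ‖y‖ ^ 2) x ν (t - ε ^ 2 / 2) with hF
  have hlow : ∀ ν ∈ sphere (0 : EuclideanSpace ℝ (Fin n)) 1, K ≤ F ν := by
    intro ν hν
    have h := (slice_bounds hn hε x ν (by simpa using hν) K k hk).1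
    have h2 : 0 ≤ k * ‖x + ε • ν‖ ^ 2 := by positivity
    simp only [hF, dppOp, sliceAvg, ← hK]
    nlinarith [mul_le_mul_of_nonneg_left h (sub_nonneg.2 hα1.le), mul_nonneg hα.le h2]
  have hup : ∀ ν ∈ sphere (0 : EuclideanSpace ℝ (Fin n)) 1,
      F ν ≤ K + k * (‖x‖ ^ 2 + ε ^ 2) + 2 * k * α * ε * ⟪x, ν⟫ := by
    intro ν hν
    have hν1 : ‖ν‖ = 1 := by simpa using hν
    have h := (slice_bounds hn hε x ν hν1 K k hk).2
    have h2 : ‖x + ε • ν‖ ^ 2 = ‖x‖ ^ 2 + 2 * ε * ⟪x, ν⟫ + ε ^ 2 := by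
      rw [norm_add_sq_real, inner_smul_right, norm_smul, hν1, Real.norm_of_nonneg hε.le]; ring
    simp only [hF, dppOp, sliceAvg, ← hK]
    rw [h2]
    nlinarith [mul_le_mul_of_nonneg_left h (sub_nonneg.2 hα1.le)]
  obtain ⟨ν₀, hν₀, hin⟩ : ∃ ν ∈ sphere (0 : EuclideanSpace ℝ (Fin n)) 1, ⟪x, ν⟫ = -‖x‖ := by
    by_cases hx : x = 0
    · refine ⟨EuclideanSpace.single ⟨0, by omega⟩ 1, by simp, by simp [hx]⟩
    · have hx' : ‖x‖ ≠ 0 := norm_ne_zero_iff.2 hx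
      refine ⟨-(‖x‖⁻¹ • x), by simp [norm_smul, hx'], ?_⟩
      rw [inner_neg_right, inner_smul_right, real_inner_self_eq_norm_sq]
      field_simp
  have hsup : sSup (F '' sphere 0 1) ≤
      K + k * (‖x‖ ^ 2 + ε ^ 2) + 2 * k * α * ε * ‖x‖ := by
    refine csSup_le ⟨_, mem_image_of_mem F hν₀⟩ ?_
    rintro _ ⟨ν, hν, rfl⟩
    refine (hup ν hν).trans ?_
    have : ⟪x, ν⟫ ≤ ‖x‖ := by
      have := real_inner_le_norm x ν
      rwa [show ‖ν‖ = 1 by simpa using hν, mul_one] at this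
    gcongr
  have hinf : sInf (F '' sphere 0 1) ≤
      K + k * (‖x‖ ^ 2 + ε ^ 2) - 2 * k * α * ε * ‖x‖ := by
    refine (csInf_le ⟨K, ?_⟩ (mem_image_of_mem F hν₀)).trans ?_
    · rintro _ ⟨ν, hν, rfl⟩
      exact hlow ν hν
    · have := hup ν₀ hν₀
      rw [hin] at this
      linarith
  have : dppMidrange n α ε
      (fun y s => c + 7 * (r ^ 2)⁻¹ * A * s + k * ‖y‖ ^ 2) x (t - ε ^ 2 / 2) =
      (1/2) * sSup (F '' sphere 0 1) + (1/2) * sInf (F '' sphere 0 1) := rfl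
  rw [this]
  calc _ ≤ K + k * (‖x‖ ^ 2 + ε ^ 2) := by linarith
    _ = _ := by rw [hK, hkdef]; ring
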